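/- arXiv:2202.00104 — 2 statements merged into one kernel-verified Lean document; each statement's English description precedes it below -/
import Mathlib

section
/- (Population increase bound.) In the linear-dynamics setting, let (c, a) be a team of n agents and let (c⁺, a⁺) be the (n+1)-agent team obtained by adding an agent with capability c_{n+1} ∈ ℝ^d and weight a_{n+1} ∈ [0,1], scaling the original weights by λ = 1 − a_{n+1} (so a⁺ᵢ = λaᵢ for i ≤ n and a⁺_{n+1} = a_{n+1}). Let Q, Q⁺ satisfy the Bellman optimality equations for the linear dynamics of (c,a) (viewed as an (n+1)-agent team in which agent n+1 has weight 0) and of (c⁺,a⁺) respectively, with Q ≥ 0, and set s_max = max_s ‖W_R φ(s)‖₁ and V_mid = (1/2) max_{s,u} Q(s,u). Then for any initial distribution ρ, the optimal values satisfy |V*_{(c⁺,a⁺)} − V*_{(c,a)}| ≤ (a_{n+1}(s_max + γ d V_mid)/(γ(1 − γ))) · ‖Σ_{i=1}^n aᵢ cᵢ − c_{n+1}‖_∞. -/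
/-- ℓ^∞ norm on ℝ^d. -/
noncomputable def linf {d : ℕ} (x : Fin d → ℝ) : ℝ := ⨆ j, |x j|

/-- Euclidean inner product on ℝ^d. -/
def dot {d : ℕ} (x y : Fin d → ℝ) : ℝ := ∑ j, x j * y j

/-- ℓ¹ norm on ℝ^k. -/
def l1 {k : ℕ} (x : Fin k → ℝ) : ℝ := ∑ j, |x j|

theorem abs_dot_le {d : ℕ} (e w : Fin d → ℝ) : |dot e w| ≤ linf e * l1 w := by
  unfold dot l1
  rw [Finset.mul_sum]
  refine (Finset.abs_sum_le_sum_abs _ _).trans (Finset.sum_le_sum fun j _ => ?_)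
  rw [abs_mul]
  exact mul_le_mul_of_nonneg_right
    (le_ciSup (f := fun j => |e j|) (Set.finite_range _).bddAbove j) (abs_nonneg _)

theorem linf_nonneg' {d : ℕ} (e : Fin d → ℝ) : 0 ≤ linf e :=
  Real.iSup_nonneg fun _ => abs_nonneg _

theorem dot_mix {d n : ℕ} (c : Fin n → Fin d → ℝ) (cnew : Fin d → ℝ) (a : Fin n → ℝ)
    (t : ℝ) (w : Fin d → ℝ) :
    ((∑ i, (1 - t) * a i * dot (c i) w) + t * dot cnew w) - ∑ i, a i * dot (c i) w
      = -t * dot (fun j => (∑ i, a i * c i j) - cnew j) w := by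
  have h1 : ∑ i, (1 - t) * a i * dot (c i) w = (1 - t) * ∑ i, a i * dot (c i) w := by
    rw [Finset.mul_sum]
    exact Finset.sum_congr rfl fun i _ => by ring
  have h2 : dot (fun j => (∑ i, a i * c i j) - cnew j) w
      = (∑ i, a i * dot (c i) w) - dot cnew w := by
    unfold dot
    simp only [sub_mul, Finset.sum_sub_distrib, Finset.sum_mul, Finset.mul_sum]
    rw [Finset.sum_comm]
    simp only [mul_assoc]
  rw [h1, h2]; ring

theorem abs_iSup_sub_le {U : Type*} [Fintype U] [Nonempty U] (f g : U → ℝ) (B : ℝ)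
    (h : ∀ u, |f u - g u| ≤ B) : |(⨆ u, f u) - ⨆ u, g u| ≤ B := by
  have hf : ∀ u, f u ≤ ⨆ u, f u := le_ciSup (Set.finite_range f).bddAbove
  have hg : ∀ u, g u ≤ ⨆ u, g u := le_ciSup (Set.finite_range g).bddAbove
  rw [abs_le]
  constructor
  · have : (⨆ u, g u) ≤ (⨆ u, f u) + B :=
      ciSup_le fun u => by linarith [(abs_le.1 (h u)).1, hf u]
    linarith
  · have : (⨆ u, f u) ≤ (⨆ u, g u) + B :=
      ciSup_le fun u => by linarith [(abs_le.1 (h u)).2, hg u]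
    linarith

theorem abs_wsum_le {S : Type*} [Fintype S] (p x : S → ℝ) (B : ℝ) (hp : ∀ s, 0 ≤ p s)
    (hs : ∑ s, p s = 1) (h : ∀ s, |x s| ≤ B) : |∑ s, p s * x s| ≤ B := by
  calc |∑ s, p s * x s| ≤ ∑ s, |p s * x s| := Finset.abs_sum_le_sum_abs _ _
    _ ≤ ∑ s, p s * B := Finset.sum_le_sum fun s _ => by
        rw [abs_mul, abs_of_nonneg (hp s)]
        exact mul_le_mul_of_nonneg_left (h s) (hp s)
    _ = B := by rw [← Finset.sum_mul, hs, one_mul]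

/-- Population increase bound: adding an agent with capability `cnew` and weight
`anew` (original weights scaled by `λ = 1 - anew`) changes the optimal value by
at most `anew (s_max + γ d V_mid)/(γ(1-γ)) ‖Σᵢ aᵢ cᵢ - cnew‖_∞`. -/
theorem population_increase_bound
    {S U : Type*} [Fintype S] [Nonempty S] [Fintype U] [Nonempty U]
    {k d n : ℕ} (γ : ℝ) (hγ0 : 0 < γ) (hγ1 : γ < 1)
    (φ : S → Fin k → ℝ) (WR : Matrix (Fin d) (Fin k) ℝ)
    (WP : S → U → S → Fin d → ℝ)
    (hWPpos : ∀ s u s' j, 0 ≤ WP s u s' j)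
    (hWPsum : ∀ s u (j : Fin d), ∑ s', WP s u s' j = 1)
    (c : Fin n → Fin d → ℝ) (cnew : Fin d → ℝ)
    (a : Fin n → ℝ) (hapos : ∀ i, 0 ≤ a i) (hasum : ∑ i, a i = 1)
    (anew : ℝ) (hanew0 : 0 ≤ anew) (hanew1 : anew ≤ 1)
    (R Rplus : S → ℝ) (P Pplus : S → U → S → ℝ)
    (hR : ∀ s, R s = ∑ i, a i * dot (c i) (WR.mulVec (φ s)))
    (hRplus : ∀ s, Rplus s =
      (∑ i, (1 - anew) * a i * dot (c i) (WR.mulVec (φ s))) +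
        anew * dot cnew (WR.mulVec (φ s)))
    (hP : ∀ s u s', P s u s' = ∑ i, a i * dot (c i) (WP s u s'))
    (hPplus : ∀ s u s', Pplus s u s' =
      (∑ i, (1 - anew) * a i * dot (c i) (WP s u s')) + anew * dot cnew (WP s u s'))
    (hPpos : ∀ s u s', 0 ≤ P s u s') (hPsum : ∀ s u, ∑ s', P s u s' = 1)
    (hPpluspos : ∀ s u s', 0 ≤ Pplus s u s') (hPplussum : ∀ s u, ∑ s', Pplus s u s' = 1)
    (Q Qplus : S → U → ℝ)
    (hQ : ∀ s u, Q s u = R s + γ * ∑ s', P s u s' * (⨆ u', Q s' u'))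
    (hQplus : ∀ s u, Qplus s u = Rplus s + γ * ∑ s', Pplus s u s' * (⨆ u', Qplus s' u'))
    (hQpos : ∀ s u, 0 ≤ Q s u)
    (ρ : S → ℝ) (hρpos : ∀ s, 0 ≤ ρ s) (hρsum : ∑ s, ρ s = 1) :
    |(∑ s, ρ s * (⨆ u, Qplus s u)) - ∑ s, ρ s * (⨆ u, Q s u)| ≤
      anew * ((⨆ s, l1 (WR.mulVec (φ s))) + γ * d * ((1/2) * ⨆ s, ⨆ u, Q s u)) /
        (γ * (1 - γ)) *
        linf (fun j => (∑ i, a i * c i j) - cnew j) := by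
  set e : Fin d → ℝ := fun j => (∑ i, a i * c i j) - cnew j with he
  set M : ℝ := ⨆ s, ⨆ u, Q s u with hM
  set m : ℝ := ⨆ s, l1 (WR.mulVec (φ s)) with hm
  set V : S → ℝ := fun s => ⨆ u, Q s u with hV
  set W : S → ℝ := fun s => ⨆ u, Qplus s u with hW
  have hE : 0 ≤ linf e := linf_nonneg' e
  have hV0 : ∀ s, 0 ≤ V s := fun s => Real.iSup_nonneg fun u => hQpos s u
  have hVM : ∀ s, V s ≤ M := fun s => le_ciSup (f := V) (Set.finite_range _).bddAbove s
  have hM0 : 0 ≤ M := Real.iSup_nonneg hV0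
  have hm0 : 0 ≤ m := Real.iSup_nonneg fun s => Finset.sum_nonneg fun j _ => abs_nonneg _
  have hRd : ∀ s, |Rplus s - R s| ≤ anew * (linf e * m) := by
    intro s
    rw [hRplus, hR, dot_mix, abs_mul, abs_neg, abs_of_nonneg hanew0]
    refine mul_le_mul_of_nonneg_left ((abs_dot_le _ _).trans ?_) hanew0
    exact mul_le_mul_of_nonneg_left
      (le_ciSup (f := fun s => l1 (WR.mulVec (φ s))) (Set.finite_range _).bddAbove s) hE
  have hPd : ∀ s u, |∑ s', (Pplus s u s' - P s u s') * V s'|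
      ≤ anew * (linf e * (d * (1/2 * M))) := by
    intro s u
    have h1 : ∑ s', (Pplus s u s' - P s u s') * V s'
        = ∑ s', (Pplus s u s' - P s u s') * (V s' - 1/2 * M) := by
      have : ∑ s', (Pplus s u s' - P s u s') * (1/2 * M) = 0 := by
        rw [← Finset.sum_mul, Finset.sum_sub_distrib, hPsum, hPplussum]; ring
      simp only [mul_sub (_ - _) (V _)]
      rw [Finset.sum_sub_distrib, this, sub_zero]
    rw [h1]
    have h2 : ∑ s', l1 (WP s u s') = d := by
      unfold l1
      rw [Finset.sum_comm]
      simp [abs_of_nonneg (hWPpos _ _ _ _), hWPsum]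
    calc |∑ s', (Pplus s u s' - P s u s') * (V s' - 1/2 * M)|
        ≤ ∑ s', |(Pplus s u s' - P s u s') * (V s' - 1/2 * M)| :=
          Finset.abs_sum_le_sum_abs _ _
      _ ≤ ∑ s', (anew * (linf e * l1 (WP s u s'))) * (1/2 * M) := by
          refine Finset.sum_le_sum fun s' _ => ?_
          rw [abs_mul]
          have hb : |V s' - 1/2 * M| ≤ 1/2 * M := by
            rw [abs_le]; constructor <;> linarith [hV0 s', hVM s']
          have ha : |Pplus s u s' - P s u s'| ≤ anew * (linf e * l1 (WP s u s')) := by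
            rw [hPplus, hP, dot_mix, abs_mul, abs_neg, abs_of_nonneg hanew0]
            exact mul_le_mul_of_nonneg_left (abs_dot_le _ _) hanew0
          exact mul_le_mul ha hb (abs_nonneg _) ((abs_nonneg _).trans ha)
      _ = anew * (linf e * (d * (1/2 * M))) := by
          rw [← Finset.sum_mul, ← Finset.mul_sum, ← Finset.mul_sum, h2]; ring
  obtain ⟨s0, hs0⟩ := Finite.exists_max fun s => |W s - V s|
  set δ : ℝ := |W s0 - V s0| with hδ
  set K : ℝ := anew * (m + γ * d * (1/2 * M)) * linf e with hK
  have hK0 : 0 ≤ K := by positivity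
  have hQd : ∀ s u, |Qplus s u - Q s u| ≤ K + γ * δ := by
    intro s u
    have h1 : Qplus s u - Q s u = (Rplus s - R s)
        + γ * (∑ s', (Pplus s u s' - P s u s') * V s')
        + γ * ∑ s', Pplus s u s' * (W s' - V s') := by
      rw [hQplus, hQ s u]
      simp only [sub_mul, mul_sub, Finset.sum_sub_distrib]
      ring
    have h2 := abs_wsum_le (Pplus s u) (fun s' => W s' - V s') δ (hPpluspos s u)
      (hPplussum s u) hs0
    have h3 := hPd s u
    have h4 := hRd s
    rw [h1]
    refine (abs_add_three _ _ _).trans ?_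
    rw [abs_mul, abs_mul, abs_of_pos hγ0]
    have h5 := mul_le_mul_of_nonneg_left h2 hγ0.le
    have h6 := mul_le_mul_of_nonneg_left h3 hγ0.le
    have h7 : K = anew * (linf e * m) + γ * (anew * (linf e * (d * (1/2 * M)))) := by
      rw [hK]; ring
    linarith
  have hδK : δ ≤ K + γ * δ := abs_iSup_sub_le _ _ _ (hQd s0)
  have hfin : δ ≤ K / (γ * (1 - γ)) := by
    rw [le_div_iff₀ (mul_pos hγ0 (by linarith))]
    have : δ * (1 - γ) ≤ K := by linarith
    have h8 : 0 ≤ δ * (1 - γ) := mul_nonneg (abs_nonneg _) (by linarith)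
    nlinarith
  have hsum : (∑ s, ρ s * W s) - ∑ s, ρ s * V s = ∑ s, ρ s * (W s - V s) := by
    simp only [mul_sub, Finset.sum_sub_distrib]
  rw [div_mul_eq_mul_div, hsum]
  exact (abs_wsum_le ρ _ δ hρpos hρsum hs0).trans hfin
end

section
/- (Approximately linear dynamics.) Let S, U be finite nonempty sets, γ ∈ (0,1), and let (c^x, a^x), (c^y, a^y) be two teams of n agents. Let R_x, R_y : S → ℝ and transition kernels P_x, P_y satisfy, for both teams T ∈ {x, y}: |R_T(s) − Σ_i a^T_i ⟨c^T_i, W_R φ(s)⟩| ≤ ε̂_R for all s, and Σ_{s'} |P_T(s'|s,u) − Σ_i a^T_i ⟨c^T_i, W_P(s',s,u)⟩| ≤ ε̂_P for all (s,u). Let Q_x, Q_y satisfy the Bellman optimality equations for (R_x, P_x) and (R_y, P_y) with Q_y ≥ 0, and set s_max = max_s ‖W_R φ(s)‖₁, V_mid = (1/2) max_{s,u} Q_y(s,u), Ψ = ‖Σ_i a^x_i (c^x_i − c^y_i)‖_∞ + ‖Σ_i (a^x_i − a^y_i) c^y_i‖_∞. Then for any initial distribution ρ, |V*_x − V*_y|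 ≤ ((s_max + γ d V_mid)/(γ(1 − γ))) Ψ + 2(ε̂_R + γ ε̂_P V_mid)/(γ(1 − γ)). -/
theorem aux_dot_bound {d : ℕ} (x w : Fin d → ℝ) (c : ℝ) (hx : ∀ j, |x j| ≤ c) :
    |dot x w| ≤ c * l1 w := by
  unfold dot l1
  rw [Finset.mul_sum]
  refine (Finset.abs_sum_le_sum_abs _ _).trans (Finset.sum_le_sum fun j _ => ?_)
  rw [abs_mul]
  exact mul_le_mul_of_nonneg_right (hx j) (abs_nonneg _)

theorem aux_dot_sum {d n : ℕ} (c : Fin n → Fin d → ℝ) (a : Fin n → ℝ) (w : Fin d → ℝ) :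
    ∑ i, a i * dot (c i) w = dot (fun j => ∑ i, a i * c i j) w := by
  unfold dot
  simp only [Finset.mul_sum, Finset.sum_mul]
  rw [Finset.sum_comm]
  refine Finset.sum_congr rfl fun j _ => Finset.sum_congr rfl fun i _ => by ring

theorem aux_linf {d : ℕ} (x : Fin d → ℝ) (j : Fin d) : |x j| ≤ linf x :=
  le_ciSup (f := fun j => |x j|) (Set.finite_range _).bddAbove j

theorem aux_linf_nonneg {d : ℕ} (x : Fin d → ℝ) : 0 ≤ linf x :=
  Real.iSup_nonneg fun _ => abs_nonneg _

theorem aux_sup {U : Type*} [Fintype U] [Nonempty U] (f g : U → ℝ) (C : ℝ)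
    (h : ∀ u, |f u - g u| ≤ C) : |(⨆ u, f u) - ⨆ u, g u| ≤ C := by
  have hf : ∀ u, f u ≤ ⨆ u, f u := le_ciSup (Set.finite_range f).bddAbove
  have hg : ∀ u, g u ≤ ⨆ u, g u := le_ciSup (Set.finite_range g).bddAbove
  have h1 : (⨆ u, f u) ≤ (⨆ u, g u) + C := ciSup_le fun u => by
    have := (abs_le.1 (h u)).2
    linarith [hg u]
  have h2 : (⨆ u, g u) ≤ (⨆ u, f u) + C := ciSup_le fun u => by
    have := (abs_le.1 (h u)).1
    linarith [hf u]
  rw [abs_le]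
  constructor <;> linarith

/-- Generalisation bound under approximately linear dynamics: if the rewards deviate
from linearity by at most `ε̂_R` pointwise and the kernels by at most `ε̂_P` in total
variation, the optimal-value gap picks up an extra `2(ε̂_R + γ ε̂_P V_mid)/(γ(1-γ))`. -/
theorem approximate_dynamics_generalisation
    {S U : Type*} [Fintype S] [Nonempty S] [Fintype U] [Nonempty U]
    {k d n : ℕ} (γ : ℝ) (hγ0 : 0 < γ) (hγ1 : γ < 1)
    (φ : S → Fin k → ℝ) (WR : Matrix (Fin d) (Fin k) ℝ)
    (WP : S → U → S → Fin d → ℝ)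
    (hWPpos : ∀ s u s' j, 0 ≤ WP s u s' j)
    (hWPsum : ∀ s u (j : Fin d), ∑ s', WP s u s' j = 1)
    (cx cy : Fin n → Fin d → ℝ) (ax ay : Fin n → ℝ)
    (haxpos : ∀ i, 0 ≤ ax i) (haxsum : ∑ i, ax i = 1)
    (haypos : ∀ i, 0 ≤ ay i) (haysum : ∑ i, ay i = 1)
    (εR εP : ℝ)
    (Rx Ry : S → ℝ) (Px Py : S → U → S → ℝ)
    (hRx : ∀ s, |Rx s - ∑ i, ax i * dot (cx i) (WR.mulVec (φ s))| ≤ εR)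
    (hRy : ∀ s, |Ry s - ∑ i, ay i * dot (cy i) (WR.mulVec (φ s))| ≤ εR)
    (hPx : ∀ s u, ∑ s', |Px s u s' - ∑ i, ax i * dot (cx i) (WP s u s')| ≤ εP)
    (hPy : ∀ s u, ∑ s', |Py s u s' - ∑ i, ay i * dot (cy i) (WP s u s')| ≤ εP)
    (hPxpos : ∀ s u s', 0 ≤ Px s u s') (hPxsum : ∀ s u, ∑ s', Px s u s' = 1)
    (hPypos : ∀ s u s', 0 ≤ Py s u s') (hPysum : ∀ s u, ∑ s', Py s u s' = 1)
    (Qx Qy : S → U → ℝ)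
    (hQx : ∀ s u, Qx s u = Rx s + γ * ∑ s', Px s u s' * (⨆ u', Qx s' u'))
    (hQy : ∀ s u, Qy s u = Ry s + γ * ∑ s', Py s u s' * (⨆ u', Qy s' u'))
    (hQypos : ∀ s u, 0 ≤ Qy s u)
    (ρ : S → ℝ) (hρpos : ∀ s, 0 ≤ ρ s) (hρsum : ∑ s, ρ s = 1) :
    |(∑ s, ρ s * (⨆ u, Qx s u)) - ∑ s, ρ s * (⨆ u, Qy s u)| ≤
      ((⨆ s, l1 (WR.mulVec (φ s))) + γ * d * ((1/2) * ⨆ s, ⨆ u, Qy s u)) / (γ * (1 - γ)) *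
        (linf (fun j => ∑ i, ax i * (cx i j - cy i j)) +
         linf (fun j => ∑ i, (ax i - ay i) * cy i j)) +
      2 * (εR + γ * εP * ((1/2) * ⨆ s, ⨆ u, Qy s u)) / (γ * (1 - γ)) := by
  classical
  set Ψ := linf (fun j => ∑ i, ax i * (cx i j - cy i j)) +
         linf (fun j => ∑ i, (ax i - ay i) * cy i j) with hΨ
  set sm := ⨆ s, l1 (WR.mulVec (φ s)) with hsm
  set M := (1/2) * ⨆ s, ⨆ u, Qy s u with hM
  have hΨ0 : 0 ≤ Ψ := add_nonneg (aux_linf_nonneg _) (aux_linf_nonneg _)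
  have hdiff : ∀ w : Fin d → ℝ,
      |∑ i, ax i * dot (cx i) w - ∑ i, ay i * dot (cy i) w| ≤ Ψ * l1 w := by
    intro w
    rw [aux_dot_sum, aux_dot_sum]
    have : dot (fun j => ∑ i, ax i * cx i j) w - dot (fun j => ∑ i, ay i * cy i j) w
        = dot (fun j => ∑ i, ax i * (cx i j - cy i j) + ∑ i, (ax i - ay i) * cy i j) w := by
      unfold dot
      rw [← Finset.sum_sub_distrib]
      refine Finset.sum_congr rfl fun j _ => ?_
      beta_reduce
      rw [← sub_mul, ← Finset.sum_sub_distrib, ← Finset.sum_add_distrib]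
      congr 1
      exact Finset.sum_congr rfl fun i _ => by ring
    rw [this]
    refine aux_dot_bound _ _ _ fun j => (abs_add_le _ _).trans ?_
    exact add_le_add (aux_linf (fun j => ∑ i, ax i * (cx i j - cy i j)) j)
      (aux_linf (fun j => ∑ i, (ax i - ay i) * cy i j) j)
  have hR : ∀ s, |Rx s - Ry s| ≤ sm * Ψ + 2 * εR := by
    intro s
    have h1 := hdiff (WR.mulVec (φ s))
    have h2 : l1 (WR.mulVec (φ s)) ≤ sm :=
      le_ciSup (f := fun s => l1 (WR.mulVec (φ s))) (Set.finite_range _).bddAbove s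
    have h3 := mul_le_mul_of_nonneg_left h2 hΨ0
    have h4 := abs_le.1 h1
    have h5 := abs_le.1 (hRx s)
    have h6 := abs_le.1 (hRy s)
    rw [abs_le]
    constructor <;> linarith [h4.1, h4.2, h5.1, h5.2, h6.1, h6.2]
  have hP : ∀ s u, ∑ s', |Px s u s' - Py s u s'| ≤ d * Ψ + 2 * εP := by
    intro s u
    have h1 : ∑ s', |Px s u s' - Py s u s'| ≤
        ∑ s', (|Px s u s' - ∑ i, ax i * dot (cx i) (WP s u s')|
          + |Py s u s' - ∑ i, ay i * dot (cy i) (WP s u s')| + Ψ * l1 (WP s u s')) := by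
      refine Finset.sum_le_sum fun s' _ => ?_
      have h4 := abs_le.1 (hdiff (WP s u s'))
      have h5 := abs_le.1 (le_refl |Px s u s' - ∑ i, ax i * dot (cx i) (WP s u s')|)
      have h6 := abs_le.1 (le_refl |Py s u s' - ∑ i, ay i * dot (cy i) (WP s u s')|)
      rw [abs_le]
      constructor <;> linarith [h4.1, h4.2, h5.1, h5.2, h6.1, h6.2]
    have h2 : ∑ s', l1 (WP s u s') = d := by
      unfold l1
      rw [Finset.sum_comm]
      simp [abs_of_nonneg (hWPpos _ _ _ _), hWPsum]
    rw [Finset.sum_add_distrib, Finset.sum_add_distrib, ← Finset.mul_sum, h2] at h1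
    linarith [hPx s u, hPy s u]
  have hVy0 : ∀ s, 0 ≤ ⨆ u, Qy s u := fun s => Real.iSup_nonneg fun u => hQypos s u
  have hVyM : ∀ s, (⨆ u, Qy s u) ≤ 2 * M := by
    intro s
    have : (⨆ u, Qy s u) ≤ ⨆ s, ⨆ u, Qy s u :=
      le_ciSup (f := fun s => ⨆ u, Qy s u) (Set.finite_range _).bddAbove s
    rw [hM]; linarith
  obtain ⟨s₁⟩ := ‹Nonempty S›
  obtain ⟨u₁⟩ := id ‹Nonempty U›
  have hM0 : 0 ≤ M := by linarith [hVy0 s₁, hVyM s₁]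
  have hPV : ∀ s u, |∑ s', (Px s u s' - Py s u s') * (⨆ u', Qy s' u')|
      ≤ (d * Ψ + 2 * εP) * M := by
    intro s u
    have h1 : ∑ s', (Px s u s' - Py s u s') * (⨆ u', Qy s' u')
        = ∑ s', (Px s u s' - Py s u s') * ((⨆ u', Qy s' u') - M) := by
      simp only [mul_sub, Finset.sum_sub_distrib, sub_mul, ← Finset.sum_mul, hPxsum, hPysum]
      ring
    rw [h1]
    calc _ ≤ ∑ s', |Px s u s' - Py s u s'| * M := by
          refine (Finset.abs_sum_le_sum_abs _ _).trans (Finset.sum_le_sum fun s' _ => ?_)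
          rw [abs_mul]
          refine mul_le_mul_of_nonneg_left ?_ (abs_nonneg _)
          rw [abs_le]
          constructor <;> linarith [hVy0 s', hVyM s']
      _ ≤ _ := by
          rw [← Finset.sum_mul]
          exact mul_le_mul_of_nonneg_right (hP s u) hM0
  haveI : Nonempty S := ⟨s₁⟩
  obtain ⟨s₀, hs₀⟩ := Finite.exists_max (fun s => |(⨆ u, Qx s u) - ⨆ u, Qy s u|)
  set D := |(⨆ u, Qx s₀ u) - ⨆ u, Qy s₀ u| with hD
  set B := sm * Ψ + 2 * εR + γ * ((d * Ψ + 2 * εP) * M) with hB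
  have hQ : ∀ s u, |Qx s u - Qy s u| ≤ B + γ * D := by
    intro s u
    have h1 : Qx s u - Qy s u = (Rx s - Ry s)
        + γ * (∑ s', (Px s u s' - Py s u s') * (⨆ u', Qy s' u'))
        + γ * (∑ s', Px s u s' * ((⨆ u', Qx s' u') - ⨆ u', Qy s' u')) := by
      rw [hQx s u, hQy s u]
      simp only [mul_sub, Finset.sum_sub_distrib, sub_mul]
      ring
    have h2 : |∑ s', Px s u s' * ((⨆ u', Qx s' u') - ⨆ u', Qy s' u')| ≤ D := by
      calc _ ≤ ∑ s', Px s u s' * D := by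
            refine (Finset.abs_sum_le_sum_abs _ _).trans (Finset.sum_le_sum fun s' _ => ?_)
            rw [abs_mul, abs_of_nonneg (hPxpos s u s')]
            exact mul_le_mul_of_nonneg_left (hs₀ s') (hPxpos s u s')
        _ = D := by rw [← Finset.sum_mul, hPxsum, one_mul]
    rw [h1]
    refine (abs_add_le _ _).trans (add_le_add ((abs_add_le _ _).trans (add_le_add (hR s) ?_)) ?_)
    · rw [abs_mul, abs_of_pos hγ0]
      exact mul_le_mul_of_nonneg_left (hPV s u) hγ0.le
    · rw [abs_mul, abs_of_pos hγ0]
      exact mul_le_mul_of_nonneg_left h2 hγ0.le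
  have hDB : D ≤ B + γ * D := aux_sup _ _ _ (hQ s₀)
  have hD0 : 0 ≤ D := abs_nonneg _
  have hγ' : 0 < 1 - γ := by linarith
  have hfin : D ≤ B / (γ * (1 - γ)) := by
    rw [le_div_iff₀ (mul_pos hγ0 hγ')]
    have : 0 ≤ D * (1 - γ) := mul_nonneg hD0 hγ'.le
    nlinarith
  have hsum : |(∑ s, ρ s * (⨆ u, Qx s u)) - ∑ s, ρ s * (⨆ u, Qy s u)| ≤ D := by
    rw [← Finset.sum_sub_distrib]
    calc _ ≤ ∑ s, ρ s * D := by
          refine (Finset.abs_sum_le_sum_abs _ _).trans (Finset.sum_le_sum fun s _ => ?_)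
          rw [← mul_sub, abs_mul, abs_of_nonneg (hρpos s)]
          exact mul_le_mul_of_nonneg_left (hs₀ s) (hρpos s)
      _ = D := by rw [← Finset.sum_mul, hρsum, one_mul]
  refine hsum.trans (hfin.trans (le_of_eq ?_))
  rw [hB]
  ring
end
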